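/- There exists a constant c > 0 such that for every n ≥ 1 there is a set P of n integer points in the plane with all coordinates in [0, c·n] with the following property: every simple graph G on n vertices that admits a crossing-free straight-line drawing with all vertex images in strictly convex position (i.e., every outerplanar graph on n vertices) admits a crossing-free straight-line drawing whose set of vertex images is exactly P. Consequently, any number of outerplanar graphs on n vertices can be simultaneously embedded without mapping on an O(n) × O(n) grid. -/

import Mathlib

def IsCrossingFreeDrawing {V : Type*} (G : SimpleGraph V) (f : V → ℝ × ℝ) : Prop :=
  Function.Injective f ∧
    ∀ a b c d : V, G.Adj a b → G.Adj c d → s(a, b) ≠ s(c, d) →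
      segment ℝ (f a) (f b) ∩ segment ℝ (f c) (f d) = f '' (({a, b} : Set V) ∩ {c, d})

/-- A set of points is in strictly convex position if no point of it lies in the
convex hull of the others. -/
def InStrictlyConvexPosition (s : Set (ℝ × ℝ)) : Prop :=
  ∀ p ∈ s, p ∉ convexHull ℝ (s \ {p})

/-- Regard an integer point as a point of the real plane. -/
def intToPlane (z : ℤ × ℤ) : ℝ × ℝ := ((z.1 : ℝ), (z.2 : ℝ))

/-- Twice the signed area of the triangle `p q r`. -/
def signedArea (p q r : ℝ × ℝ) : ℝ :=
  (q.1 - p.1) * (r.2 - p.2) - (q.2 - p.2) * (r.1 - p.1)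

/-- No three distinct points of `T` are collinear. -/
def InGeneralPosition (T : Finset (ℝ × ℝ)) : Prop :=
  ∀ p ∈ T, ∀ q ∈ T, ∀ r ∈ T, p ≠ q → p ≠ r → q ≠ r → signedArea p q r ≠ 0

theorem signedArea_rotate (p q r : ℝ × ℝ) : signedArea q r p = signedArea p q r := by
  unfold signedArea; ring

theorem signedArea_swap (p q r : ℝ × ℝ) : signedArea q p r = -signedArea p q r := by
  unfold signedArea; ring

theorem signedArea_combo (p q a b : ℝ × ℝ) {s t : ℝ} (h : s + t = 1) :
    signedArea p q (s • a + t • b) = s * signedArea p q a + t * signedArea p q b := by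
  obtain rfl : s = 1 - t := by linarith
  simp only [signedArea, Prod.fst_add, Prod.snd_add, Prod.smul_fst, Prod.smul_snd, smul_eq_mul]
  ring

theorem signedArea_pos_of_mem_segment {p q a b x : ℝ × ℝ} (ha : 0 < signedArea p q a)
    (hb : 0 < signedArea p q b) (hx : x ∈ segment ℝ a b) : 0 < signedArea p q x := by
  obtain ⟨s, t, hs, ht, hst, rfl⟩ := hx
  rw [signedArea_combo p q a b hst]
  rcases hs.eq_or_lt with rfl | hs
  · obtain rfl : t = 1 := by linarith
    simpa using hb
  · have := mul_pos hs ha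
    have := mul_nonneg ht hb.le
    linarith

theorem signedArea_nonneg_of_mem_segment {p q a b x : ℝ × ℝ} (ha : 0 ≤ signedArea p q a)
    (hb : 0 ≤ signedArea p q b) (hx : x ∈ segment ℝ a b) : 0 ≤ signedArea p q x := by
  obtain ⟨s, t, hs, ht, hst, rfl⟩ := hx
  rw [signedArea_combo p q a b hst]
  positivity

theorem disjoint_segment_of_separated {p q a b c d : ℝ × ℝ}
    (ha : 0 < signedArea p q a) (hb : 0 < signedArea p q b)
    (hc : signedArea p q c ≤ 0) (hd : signedArea p q d ≤ 0) :
    Disjoint (segment ℝ a b) (segment ℝ c d) := by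
  rw [Set.disjoint_left]
  intro x hx hx'
  have h1 := signedArea_pos_of_mem_segment ha hb hx
  have h2 := signedArea_nonneg_of_mem_segment (p := q) (q := p)
    (by rw [signedArea_swap]; linarith) (by rw [signedArea_swap]; linarith) hx'
  rw [signedArea_swap] at h2
  linarith

theorem segment_inter_segment_of_signedArea_ne_zero {a b c : ℝ × ℝ} (h : signedArea a b c ≠ 0) :
    segment ℝ a b ∩ segment ℝ a c = {a} := by
  ext x
  simp only [Set.mem_inter_iff, Set.mem_singleton_iff]
  constructor
  · rintro ⟨⟨s, t, hs, ht, hst, rfl⟩, ⟨s', t', hs', ht', hst', hx⟩⟩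
    have h1 := signedArea_combo a b a b hst
    have h2 := signedArea_combo a b a c hst'
    rw [hx, h1] at h2
    have e1 : signedArea a b a = 0 := by unfold signedArea; ring
    have e2 : signedArea a b b = 0 := by unfold signedArea; ring
    rw [e1, e2] at h2
    have ht0 : t' = 0 := by
      have : t' * signedArea a b c = 0 := by linarith
      exact (mul_eq_zero.1 this).resolve_right h
    obtain rfl : s' = 1 := by linarith
    rw [← hx, ht0]; simp
  · rintro rfl
    exact ⟨left_mem_segment ℝ x b, left_mem_segment ℝ x c⟩

/-- A threshold with exactly `j` of the (distinct) keys above it. -/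
theorem exists_threshold {ι : Type*} [DecidableEq ι] (key : ι → ℝ) (lb : ℝ) (S : Finset ι) :
    Set.InjOn key S → ∀ ub, lb < ub → (∀ i ∈ S, lb < key i ∧ key i < ub) →
      ∀ j ≤ S.card, ∃ s, lb < s ∧ s < ub ∧ (∀ i ∈ S, key i ≠ s) ∧
        (S.filter fun i => s < key i).card = j := by
  induction S using Finset.induction_on_max_value key with
  | empty =>
    intro _ ub hub _ j hj
    obtain ⟨s, h1, h2⟩ := exists_between hub
    exact ⟨s, h1, h2, by simp, by simp at hj; simp [hj]⟩
  | insert m S hm hmax ih =>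
    intro hinj ub hub hS j hj
    have hlt : ∀ i ∈ S, key i < key m := fun i hi =>
      lt_of_le_of_ne (hmax i hi) fun h => hm <| by
        have := hinj (by simp [hi]) (by simp) h
        exact this ▸ hi
    obtain ⟨hm1, hm2⟩ := hS m (by simp)
    cases j with
    | zero =>
      obtain ⟨s, h1, h2⟩ := exists_between hm2
      refine ⟨s, hm1.trans h1, h2, ?_, ?_⟩
      · intro i hi
        rcases Finset.mem_insert.1 hi with rfl | hi
        · exact h1.ne
        · exact ((hlt i hi).trans h1).ne
      · rw [Finset.card_eq_zero, Finset.filter_eq_empty_iff]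
        intro i hi
        rcases Finset.mem_insert.1 hi with rfl | hi
        · exact h1.not_gt
        · exact ((hlt i hi).trans h1).not_gt
    | succ j =>
      rw [Finset.card_insert_of_notMem hm] at hj
      obtain ⟨s, h1, h2, h3, h4⟩ := ih (hinj.mono (by simp)) (key m) hm1
        (fun i hi => ⟨(hS i (by simp [hi])).1, hlt i hi⟩) j (by omega)
      refine ⟨s, h1, h2.trans hm2, ?_, ?_⟩
      · intro i hi
        rcases Finset.mem_insert.1 hi with rfl | hi
        · exact h2.ne'
        · exact h3 i hi
      · rw [Finset.filter_insert, if_pos h2, Finset.card_insert_of_notMem (by simp [hm]), h4]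

/-- Among points with distinct coordinates `α`, `β`, one can find a point `u` with no point
below-right of it, and a weighting of the coordinates ranking exactly `a` points below `u`. -/
theorem exists_weight_of_rank {ι : Type*} [DecidableEq ι] (S : Finset ι) (α β : ι → ℝ)
    (hα : Set.InjOn α S) (hβ : Set.InjOn β S)
    (hgen : ∀ u ∈ S, ∀ r ∈ S, ∀ r' ∈ S, u ≠ r → u ≠ r' → r ≠ r' → ∀ s : ℝ, 0 < s → s < 1 →
      (1 - s) * α r + s * β r = (1 - s) * α u + s * β u →
      (1 - s) * α r' + s * β r' ≠ (1 - s) * α u + s * β u)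
    (a : ℕ) (ha : a < S.card) :
    ∃ u ∈ S, ∃ s : ℝ, 0 < s ∧ s < 1 ∧
      (∀ r ∈ S, r ≠ u → (1 - s) * α r + s * β r ≠ (1 - s) * α u + s * β u) ∧
      (S.filter fun r => (1 - s) * α r + s * β r < (1 - s) * α u + s * β u).card = a ∧
      (∀ r ∈ S, (1 - s) * α r + s * β r < (1 - s) * α u + s * β u → α r < α u) ∧
      (∀ r ∈ S, (1 - s) * α u + s * β u < (1 - s) * α r + s * β r → β u < β r) := by
  obtain ⟨M, hM⟩ : ∃ M : ℝ, ∀ r ∈ S, |β r| < M := by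
    obtain ⟨M, hM⟩ := (S.image fun r => |β r|).exists_le
    exact ⟨M + 1, fun r hr => by
      have := hM _ (Finset.mem_image_of_mem _ hr); linarith⟩
  have hne : S.Nonempty := Finset.card_pos.1 (by omega)
  have hM0 : 0 < M := by
    obtain ⟨r, hr⟩ := hne
    exact (abs_nonneg _).trans_lt (hM r hr)
  obtain ⟨c, -, -, hc, hcard⟩ := exists_threshold (fun r => -β r) (-M) S
    (fun x hx y hy h => hβ hx hy (neg_injective h)) M (by linarith)
    (fun r hr => ⟨by linarith [(abs_lt.1 (hM r hr)).2], by linarith [(abs_lt.1 (hM r hr)).1]⟩)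
    (a + 1) ha
  obtain ⟨u, hu, humax⟩ := Finset.exists_max_image (S.filter fun i => c < -β i) α
    (Finset.card_pos.1 (by omega))
  rw [Finset.mem_filter] at hu
  obtain ⟨huS, huc⟩ := hu
  have hempty : ∀ r ∈ S, β r < β u → α r < α u := by
    intro r hr h
    refine lt_of_le_of_ne (humax r (Finset.mem_filter.2 ⟨hr, by linarith⟩)) fun h' => ?_
    rw [hα hr huS h'] at h
    exact lt_irrefl _ h
  set F := S.filter fun r => β r < β u with hF
  set D := S.filter fun r => α r < α u ∧ β u < β r with hD
  have hFa : F.card ≤ a := by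
    have h1 : F ⊆ (S.filter fun i => c < -β i).erase u := by
      intro r hr
      simp only [hF, Finset.mem_filter] at hr
      simp only [Finset.mem_erase, Finset.mem_filter]
      exact ⟨fun h => by rw [h] at hr; linarith [hr.2], hr.1, by linarith⟩
    have := Finset.card_le_card h1
    rw [Finset.card_erase_of_mem (Finset.mem_filter.2 ⟨huS, huc⟩)] at this
    omega
  have hFD : a ≤ F.card + D.card := by
    have h1 : (S.filter fun i => c < -β i).erase u ⊆ F ∪ D := by
      intro r hr
      simp only [Finset.mem_erase, Finset.mem_filter] at hr
      obtain ⟨hru, hrS, hrc⟩ := hr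
      simp only [hF, hD, Finset.mem_union, Finset.mem_filter]
      rcases lt_trichotomy (β r) (β u) with h | h | h
      · exact Or.inl ⟨hrS, h⟩
      · exact absurd (hβ hrS huS h) hru
      · refine Or.inr ⟨hrS, lt_of_le_of_ne (humax r (Finset.mem_filter.2 ⟨hrS, hrc⟩)) ?_, h⟩
        exact fun h' => hru (hα hrS huS h')
    have h2 := Finset.card_le_card h1
    rw [Finset.card_erase_of_mem (Finset.mem_filter.2 ⟨huS, huc⟩)] at h2
    have := Finset.card_union_le F D
    omega
  have hDmem : ∀ r ∈ D, r ∈ S ∧ 0 < α u - α r ∧ 0 < β r - β u := by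
    intro r hr
    simp only [hD, Finset.mem_filter] at hr
    exact ⟨hr.1, by linarith [hr.2.1], by linarith [hr.2.2]⟩
  set t : ι → ℝ := fun r => (α u - α r) / ((α u - α r) + (β r - β u)) with ht
  have ht01 : ∀ r ∈ D, 0 < t r ∧ t r < 1 := by
    intro r hr
    obtain ⟨-, h1, h2⟩ := hDmem r hr
    refine ⟨by simp only [ht]; positivity, ?_⟩
    simp only [ht]
    rw [div_lt_one (by positivity)]
    linarith
  have htmul : ∀ r ∈ D, t r * ((α u - α r) + (β r - β u)) = α u - α r := by
    intro r hr
    obtain ⟨-, h1, h2⟩ := hDmem r hr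
    simp only [ht]
    field_simp
  have htinj : Set.InjOn t D := by
    intro r hr r' hr' h
    by_contra hne
    obtain ⟨h1, h2, h3⟩ := hDmem r hr
    obtain ⟨h1', h2', h3'⟩ := hDmem r' hr'
    obtain ⟨h4, h5⟩ := ht01 r hr
    have e1 := htmul r hr
    have e2 := htmul r' hr'
    rw [← h] at e2
    exact hgen u huS r h1 r' h1' (by rintro rfl; simp at h2) (by rintro rfl; simp at h2') hne
      (t r) h4 h5 (by linarith) (by linarith)
  obtain ⟨s, hs0, hs1, hst, hscard⟩ := exists_threshold t 0 D htinj 1 one_pos ht01 (a - F.card)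
    (by omega)
  have hDlt : ∀ r ∈ D, ((1 - s) * α r + s * β r < (1 - s) * α u + s * β u ↔ s < t r) := by
    intro r hr
    obtain ⟨-, h1, h2⟩ := hDmem r hr
    have e := htmul r hr
    have h3 : s * _ < t r * _ ↔ s < t r := mul_lt_mul_iff_left₀ (add_pos h1 h2)
    rw [← h3, e]
    constructor <;> intro h <;> linarith
  have hFlt : ∀ r ∈ F, (1 - s) * α r + s * β r < (1 - s) * α u + s * β u := by
    intro r hr
    simp only [hF, Finset.mem_filter] at hr
    have := hempty r hr.1 hr.2
    have := mul_lt_mul_of_pos_left this (sub_pos.2 hs1)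
    have := mul_lt_mul_of_pos_left hr.2 hs0
    linarith
  have hleft : ∀ r ∈ S, (1 - s) * α r + s * β r < (1 - s) * α u + s * β u → α r < α u := by
    intro r hr h
    by_cases hb : β r < β u
    · exact hempty r hr hb
    · have := mul_le_mul_of_nonneg_left (not_lt.1 hb) hs0.le
      exact lt_of_mul_lt_mul_left (by linarith : (1 - s) * α r < (1 - s) * α u) (by linarith)
  refine ⟨u, huS, s, hs0, hs1, ?_, ?_, hleft, ?_⟩
  · intro r hr hru heq
    rcases lt_trichotomy (β r) (β u) with h | h | h
    · exact (hFlt r (Finset.mem_filter.2 ⟨hr, h⟩)).ne heq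
    · exact hru (hβ hr huS h)
    · have h3 := mul_lt_mul_of_pos_left h hs0
      have h4 : α r < α u :=
        lt_of_mul_lt_mul_left (by linarith : (1 - s) * α r < (1 - s) * α u) (by linarith)
      have hrD : r ∈ D := Finset.mem_filter.2 ⟨hr, h4, h⟩
      refine hst r hrD ?_
      have e := htmul r hrD
      obtain ⟨-, h1, h2⟩ := hDmem r hrD
      refine mul_right_cancel₀ (add_pos h1 h2).ne' ?_
      rw [e]
      linarith
  · have : (S.filter fun r => (1 - s) * α r + s * β r < (1 - s) * α u + s * β u) =
        F ∪ D.filter fun r => s < t r := by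
      ext r
      simp only [Finset.mem_union, Finset.mem_filter]
      constructor
      · rintro ⟨hr, h⟩
        rcases lt_trichotomy (β r) (β u) with hb | hb | hb
        · exact Or.inl (Finset.mem_filter.2 ⟨hr, hb⟩)
        · rw [hβ hr huS hb] at h
          exact absurd h (lt_irrefl _)
        · have hrD : r ∈ D := Finset.mem_filter.2 ⟨hr, hleft r hr h, hb⟩
          exact Or.inr ⟨hrD, (hDlt r hrD).1 h⟩
      · rintro (h | ⟨h, h'⟩)
        · exact ⟨(Finset.mem_filter.1 h).1, hFlt r h⟩
        · exact ⟨(Finset.mem_filter.1 h).1, (hDlt r h).2 h'⟩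
    rw [this, Finset.card_union_of_disjoint, hscard]
    · omega
    · rw [Finset.disjoint_left]
      intro r hr hr'
      have h1 := (Finset.mem_filter.1 hr).2
      have h2 := (hDmem r (Finset.mem_filter.1 hr').1).2.2
      linarith
  · intro r hr h
    by_contra hb
    rcases (not_lt.1 hb).eq_or_lt with hb | hb
    · rw [hβ hr huS hb] at h
      exact lt_irrefl _ h
    · exact lt_asymm h (hFlt r (Finset.mem_filter.2 ⟨hr, hb⟩))

theorem InGeneralPosition.mono {S T : Finset (ℝ × ℝ)} (hT : InGeneralPosition T) (h : S ⊆ T) :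
    InGeneralPosition S :=
  fun p hp q hq r hr => hT p (h hp) q (h hq) r (h hr)

/-- Given a hull edge `p q` of a point set in general position, there is a point `u` of the set and
a line through `u` crossing `p q` that splits the remaining points in a prescribed proportion, such
that `p u` and `u q` are hull edges of the two parts. -/
theorem exists_split {T : Finset (ℝ × ℝ)} (hT : InGeneralPosition T) {p q : ℝ × ℝ} (hp : p ∈ T)
    (hq : q ∈ T) (hpq : p ≠ q) (hull : ∀ r ∈ T, r ≠ p → r ≠ q → 0 < signedArea p q r)
    {a : ℕ} (ha : a + 2 < T.card) :
    ∃ u ∈ T, u ≠ p ∧ u ≠ q ∧ ∃ w, 0 < signedArea w u p ∧ signedArea w u q < 0 ∧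
      (∀ r ∈ T, r ≠ u → signedArea w u r ≠ 0) ∧
      (T.filter fun r => 0 < signedArea w u r).card = a + 1 ∧
      (∀ r ∈ T, r ≠ p → 0 < signedArea w u r → 0 < signedArea p u r) ∧
      (∀ r ∈ T, r ≠ q → signedArea w u r < 0 → 0 < signedArea u q r) := by
  set S := (T.erase p).erase q with hS
  have memS : ∀ r, r ∈ S ↔ r ≠ q ∧ r ≠ p ∧ r ∈ T := by
    intro r; simp [hS]
  have hpT : q ∈ T.erase p := Finset.mem_erase.2 ⟨hpq.symm, hq⟩
  have hScard : S.card + 2 = T.card := by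
    have h1 : S.card + 1 = _ := Finset.card_erase_add_one hpT
    have h2 := Finset.card_erase_add_one hp
    omega
  have hpos : ∀ r ∈ S, 0 < signedArea p q r := fun r hr =>
    hull r ((memS r).1 hr).2.2 ((memS r).1 hr).2.1 ((memS r).1 hr).1
  have hW : 0 < (q.1 - p.1) ^ 2 + (q.2 - p.2) ^ 2 := by
    rcases lt_or_ge 0 ((q.1 - p.1) ^ 2 + (q.2 - p.2) ^ 2) with h | h
    · exact h
    · refine absurd (Prod.ext ?_ ?_) hpq <;>
        nlinarith [sq_nonneg (q.1 - p.1), sq_nonneg (q.2 - p.2)]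
  let α : ℝ × ℝ → ℝ := fun r =>
    ((r.1 - p.1) * (q.1 - p.1) + (r.2 - p.2) * (q.2 - p.2)) / signedArea p q r
  let β : ℝ × ℝ → ℝ := fun r =>
    ((r.1 - q.1) * (q.1 - p.1) + (r.2 - q.2) * (q.2 - p.2)) / signedArea p q r
  let w : ℝ → ℝ × ℝ := fun s => (p.1 + s * (q.1 - p.1), p.2 + s * (q.2 - p.2))
  have key : ∀ s, ∀ u ∈ S, ∀ r ∈ S,
      signedArea (w s) u r * ((q.1 - p.1) ^ 2 + (q.2 - p.2) ^ 2) =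
        signedArea p q u * signedArea p q r *
          (((1 - s) * α u + s * β u) - ((1 - s) * α r + s * β r)) := by
    intro s u hu r hr
    have h1 := (hpos u hu).ne'
    have h2 := (hpos r hr).ne'
    simp only [α, β]
    field_simp
    simp only [w, signedArea]
    ring
  have hlt : ∀ s, ∀ u ∈ S, ∀ r ∈ S,
      ((1 - s) * α r + s * β r < (1 - s) * α u + s * β u ↔ 0 < signedArea (w s) u r) := by
    intro s u hu r hr
    have h1 := mul_pos (hpos u hu) (hpos r hr)
    rw [← mul_pos_iff_of_pos_right hW, key s u hu r hr, mul_pos_iff_of_pos_left h1, sub_pos]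
  have hgt : ∀ s, ∀ u ∈ S, ∀ r ∈ S,
      ((1 - s) * α u + s * β u < (1 - s) * α r + s * β r ↔ signedArea (w s) u r < 0) := by
    intro s u hu r hr
    rw [hlt s r hr u hu, show signedArea (w s) r u = -signedArea (w s) u r by
      unfold signedArea; ring]
    exact neg_pos
  have heq : ∀ s, ∀ u ∈ S, ∀ r ∈ S,
      ((1 - s) * α r + s * β r = (1 - s) * α u + s * β u ↔ signedArea (w s) u r = 0) := by
    intro s u hu r hr
    rw [le_antisymm_iff, le_antisymm_iff, ← not_lt, ← not_lt, ← not_lt, ← not_lt,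
      hlt s u hu r hr, hgt s u hu r hr, and_comm]
  have hw0 : w 0 = p := by simp [w]
  have hw1 : w 1 = q := by simp [w]
  have hα : Set.InjOn α S := by
    intro u hu r hr h
    by_contra hne
    have := (heq 0 u hu r hr).1 (by simp [h])
    rw [hw0] at this
    have h1 := (memS u).1 hu
    have h2 := (memS r).1 hr
    exact hT p hp u h1.2.2 r h2.2.2 h1.2.1.symm h2.2.1.symm hne this
  have hβ : Set.InjOn β S := by
    intro u hu r hr h
    by_contra hne
    have := (heq 1 u hu r hr).1 (by simp [h])
    rw [hw1] at this
    have h1 := (memS u).1 hu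
    have h2 := (memS r).1 hr
    exact hT q hq u h1.2.2 r h2.2.2 h1.1.symm h2.1.symm hne this
  obtain ⟨u, hu, s, hs0, hs1, hne, hcard, hleft, hright⟩ := exists_weight_of_rank S α β hα hβ
    (by
      intro u hu r hr r' hr' h1 h2 h3 s _ _ h4 h5
      rw [heq s u hu r hr] at h4
      rw [heq s u hu r' hr'] at h5
      refine hT u ((memS u).1 hu).2.2 r ((memS r).1 hr).2.2 r' ((memS r').1 hr').2.2 h1 h2 h3 ?_
      refine (mul_eq_zero.1 ?_).resolve_right (hpos u hu).ne'
      simp only [w, signedArea] at h4 h5 ⊢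
      linear_combination ((q.1 - p.1) * (r.2 - u.2) - (q.2 - p.2) * (r.1 - u.1)) * h5 -
        ((q.1 - p.1) * (r'.2 - u.2) - (q.2 - p.2) * (r'.1 - u.1)) * h4) a (by omega)
  obtain ⟨huq, hup, huT⟩ := (memS u).1 hu
  have hwp : 0 < signedArea (w s) u p := by
    have : signedArea (w s) u p = s * signedArea p q u := by simp only [w, signedArea]; ring
    rw [this]; exact mul_pos hs0 (hpos u hu)
  have hwq : signedArea (w s) u q < 0 := by
    have : signedArea (w s) u q = -((1 - s) * signedArea p q u) := by
      simp only [w, signedArea]; ring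
    rw [this, neg_lt_zero]; exact mul_pos (by linarith) (hpos u hu)
  refine ⟨u, huT, hup, huq, w s, hwp, hwq, ?_, ?_, ?_, ?_⟩
  · intro r hr hru
    by_cases hrp : r = p
    · rw [hrp]; exact hwp.ne'
    by_cases hrq : r = q
    · rw [hrq]; exact hwq.ne
    have hrS : r ∈ S := (memS r).2 ⟨hrq, hrp, hr⟩
    rw [Ne, ← heq s u hu r hrS]
    exact hne r hrS hru
  · have : (T.filter fun r => 0 < signedArea (w s) u r) =
        insert p (S.filter fun r => (1 - s) * α r + s * β r < (1 - s) * α u + s * β u) := by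
      ext r
      simp only [Finset.mem_insert, Finset.mem_filter]
      constructor
      · rintro ⟨hr, h⟩
        by_cases hrp : r = p
        · exact Or.inl hrp
        · have hrS : r ∈ S := (memS r).2 ⟨by rintro rfl; exact lt_asymm h hwq, hrp, hr⟩
          exact Or.inr ⟨hrS, (hlt s u hu r hrS).2 h⟩
      · rintro (rfl | ⟨hr, h⟩)
        · exact ⟨hp, hwp⟩
        · exact ⟨((memS r).1 hr).2.2, (hlt s u hu r hr).1 h⟩
    rw [this, Finset.card_insert_of_notMem, hcard]
    simp [hS]
  · intro r hr hrp h
    have hrS : r ∈ S := (memS r).2 ⟨by rintro rfl; exact lt_asymm h hwq, hrp, hr⟩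
    have := hleft r hrS ((hlt s u hu r hrS).2 h)
    rw [← hw0]
    exact (hlt 0 u hu r hrS).1 (by simpa using this)
  · intro r hr hrq h
    have hrS : r ∈ S := (memS r).2 ⟨hrq, by rintro rfl; exact lt_asymm h hwp, hr⟩
    have := hright r hrS ((hgt s u hu r hrS).2 h)
    have h2 := (hgt 1 u hu r hrS).1 (by simpa using this)
    rw [hw1] at h2
    rw [signedArea_swap]
    linarith

/-- A non-crossing graph on the consecutive vertices `lo, …, hi` can be drawn on any point set in
general position with matching cardinality, with `lo hi` drawn as a prescribed hull edge. -/
theorem exists_drawing_of_noncrossing (R : ℕ → ℕ → Prop)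
    (hR : ∀ a b c d, a < b → b < c → c < d → R a c → ¬ R b d) (m : ℕ) :
    ∀ lo hi, hi = lo + m + 1 → ∀ (T : Finset (ℝ × ℝ)) (p q : ℝ × ℝ), T.card = m + 2 →
      InGeneralPosition T → p ∈ T → q ∈ T → p ≠ q →
      (∀ r ∈ T, r ≠ p → r ≠ q → 0 < signedArea p q r) →
      ∃ f : ℕ → ℝ × ℝ, f lo = p ∧ f hi = q ∧ Set.InjOn f (Set.Icc lo hi) ∧
        Set.MapsTo f (Set.Icc lo hi) T ∧
        ∀ a b c d, lo ≤ a → a < b → b ≤ hi → lo ≤ c → c < d → d ≤ hi → R a b → R c d →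
          a ≠ c → a ≠ d → b ≠ c → b ≠ d →
            Disjoint (segment ℝ (f a) (f b)) (segment ℝ (f c) (f d)) := by
  induction m using Nat.strong_induction_on with
  | _ m ih =>
  intro lo hi hhi T p q hcard hT hp hq hpq hull
  rcases Nat.eq_zero_or_pos m with rfl | hm
  · refine ⟨fun i => if i = lo then p else q, by simp, by simp [hhi], ?_, ?_, ?_⟩
    · intro i hi j hj h
      simp only [Set.mem_Icc] at hi hj
      simp only at h
      split_ifs at h <;> first | omega | exact absurd h hpq | exact absurd h.symm hpq
    · intro i _
      simp only
      split_ifs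
      exacts [hp, hq]
    · intros; omega
  obtain ⟨k, hlk, hki, hk⟩ : ∃ k, lo < k ∧ k < hi ∧
      ∀ a b, lo ≤ a → a < k → k < b → b ≤ hi → R a b → a = lo ∧ b = hi := by
    by_cases hex : ∃ k, lo < k ∧ k < hi ∧ R lo k
    · obtain ⟨k0, hk0⟩ := hex
      classical
      obtain ⟨k, hk, hmax⟩ := Finset.exists_max_image
        ((Finset.range hi).filter fun k => lo < k ∧ R lo k) id
        ⟨k0, by simp [hk0.1, hk0.2.1, hk0.2.2]⟩
      simp only [Finset.mem_filter, Finset.mem_range, id] at hk hmax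
      refine ⟨k, hk.2.1, hk.1, ?_⟩
      intro a b h1 h2 h3 h4 hab
      rcases h1.eq_or_lt with rfl | h1
      · refine ⟨rfl, ?_⟩
        by_contra hb
        have := hmax b ⟨by omega, by omega, hab⟩
        omega
      · exact absurd hab (hR lo a k b h1 h2 h3 hk.2.2)
    · refine ⟨lo + 1, by omega, by omega, ?_⟩
      intro a b h1 h2 h3 h4 hab
      obtain rfl : a = lo := by omega
      refine ⟨rfl, ?_⟩
      by_contra hb
      exact hex ⟨b, by omega, by omega, hab⟩
  obtain ⟨u, hu, hup, huq, w, hwp, hwq, hwne, hwcard, hA, hB⟩ :=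
    exists_split hT hp hq hpq hull (a := k - lo - 1) (by omega)
  have hwu : signedArea w u u = 0 := by unfold signedArea; ring
  set A := T.filter fun r => 0 < signedArea w u r with hAdef
  set B := T.filter fun r => signedArea w u r < 0 with hBdef
  have huA : u ∉ A := by simp [hAdef, hwu]
  have huB : u ∉ B := by simp [hBdef, hwu]
  have hABcard : A.card + B.card + 1 = T.card := by
    have h1 : T.erase u = A ∪ B := by
      ext r
      simp only [hAdef, hBdef, Finset.mem_erase, Finset.mem_union, Finset.mem_filter]
      constructor
      · rintro ⟨h1, h2⟩
        rcases (hwne r h2 h1).lt_or_gt with h | h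
        · exact Or.inr ⟨h2, h⟩
        · exact Or.inl ⟨h2, h⟩
      · rintro (⟨h1, h2⟩ | ⟨h1, h2⟩)
        · exact ⟨by rintro rfl; linarith, h1⟩
        · exact ⟨by rintro rfl; linarith, h1⟩
    have h2 : Disjoint A B := by
      rw [Finset.disjoint_left]
      intro r h1 h2
      exact lt_asymm (Finset.mem_filter.1 h1).2 (Finset.mem_filter.1 h2).2
    have h3 := Finset.card_erase_add_one hu
    rw [h1, Finset.card_union_of_disjoint h2] at h3
    exact h3
  have hsubA : insert u A ⊆ T := Finset.insert_subset hu (Finset.filter_subset _ _)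
  have hsubB : insert u B ⊆ T := Finset.insert_subset hu (Finset.filter_subset _ _)
  have hposA : ∀ r ∈ insert u A, r ≠ u → 0 < signedArea w u r := fun r hr hru =>
    (Finset.mem_filter.1 ((Finset.mem_insert.1 hr).resolve_left hru)).2
  have hnegB : ∀ r ∈ insert u B, r ≠ u → signedArea w u r < 0 := fun r hr hru =>
    (Finset.mem_filter.1 ((Finset.mem_insert.1 hr).resolve_left hru)).2
  obtain ⟨f₁, hf₁lo, hf₁k, hf₁inj, hf₁maps, hf₁⟩ := ih (k - lo - 1) (by omega) lo k (by omega)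
    (insert u A) p u (by rw [Finset.card_insert_of_notMem huA]; omega) (hT.mono hsubA)
    (by simp [hAdef, hp, hwp]) (by simp) hup.symm
    (fun r hr hrp hru => hA r (hsubA hr) hrp (hposA r hr hru))
  obtain ⟨f₂, hf₂k, hf₂hi, hf₂inj, hf₂maps, hf₂⟩ := ih (hi - k - 1) (by omega) k hi (by omega)
    (insert u B) u q (by rw [Finset.card_insert_of_notMem huB]; omega) (hT.mono hsubB)
    (by simp) (by simp [hBdef, hq, hwq]) huq
    (fun r hr hru hrq => hB r (hsubB hr) hrq (hnegB r hr hru))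
  set f : ℕ → ℝ × ℝ := fun i => if i ≤ k then f₁ i else f₂ i with hf
  have hfl : ∀ i, i ≤ k → f i = f₁ i := fun i hi => if_pos hi
  have hfr : ∀ i, k ≤ i → f i = f₂ i := by
    intro i hi
    rcases hi.eq_or_lt with rfl | hi
    · rw [hfl _ le_rfl, hf₁k, hf₂k]
    · exact if_neg (by omega)
  have hLpos : ∀ i, lo ≤ i → i < k → 0 < signedArea w u (f i) := by
    intro i h1 h2
    rw [hfl i h2.le]
    refine hposA _ (hf₁maps ⟨h1, h2.le⟩) fun h => ?_
    exact h2.ne (hf₁inj ⟨h1, h2.le⟩ ⟨hlk.le, le_rfl⟩ (h.trans hf₁k.symm))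
  have hLneg : ∀ i, k < i → i ≤ hi → signedArea w u (f i) < 0 := by
    intro i h1 h2
    rw [hfr i h1.le]
    refine hnegB _ (hf₂maps ⟨h1.le, h2⟩) fun h => ?_
    exact h1.ne' (hf₂inj ⟨h1.le, h2⟩ ⟨le_rfl, hki.le⟩ (h.trans hf₂k.symm))
  have hLk : signedArea w u (f k) = 0 := by rw [hfl k le_rfl, hf₁k, hwu]
  have hflo : f lo = p := by rw [hfl lo hlk.le, hf₁lo]
  have hfhi : f hi = q := by rw [hfr hi hki.le, hf₂hi]
  have hmaps : Set.MapsTo f (Set.Icc lo hi) T := by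
    intro i hi
    rcases le_total i k with h | h
    · rw [hfl i h]; exact hsubA (hf₁maps ⟨hi.1, h⟩)
    · rw [hfr i h]; exact hsubB (hf₂maps ⟨h, hi.2⟩)
  have hinj' : ∀ i j, lo ≤ i → i < j → j ≤ hi → f i ≠ f j := by
    intro i j h1 h2 h3 h
    rcases le_or_gt j k with hj | hj
    · rw [hfl i (by omega), hfl j hj] at h
      exact h2.ne (hf₁inj ⟨h1, by omega⟩ ⟨by omega, hj⟩ h)
    rcases le_or_gt k i with hi | hi
    · rw [hfr i hi, hfr j hj.le] at h
      exact h2.ne (hf₂inj ⟨hi, by omega⟩ ⟨hj.le, h3⟩ h)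
    have := hLpos i h1 hi
    rw [h] at this
    exact lt_asymm this (hLneg j hj h3)
  have hinj : Set.InjOn f (Set.Icc lo hi) := by
    intro i hi j hj h
    rcases lt_trichotomy i j with h' | h' | h'
    · exact absurd h (hinj' i j hi.1 h' hj.2)
    · exact h'
    · exact absurd h.symm (hinj' j i hj.1 h' hi.2)
  have hbase : ∀ c d, lo < c → c < d → d < hi →
      Disjoint (segment ℝ (f c) (f d)) (segment ℝ (f lo) (f hi)) := by
    intro c d h1 h2 h3
    have hpos : ∀ i, lo < i → i < hi → 0 < signedArea p q (f i) := by
      intro i h1 h2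
      refine hull _ (hmaps ⟨h1.le, h2.le⟩) ?_ ?_
      · rw [← hflo]; exact (hinj' lo i le_rfl h1 h2.le).symm
      · rw [← hfhi]; exact hinj' i hi h1.le h2 le_rfl
    refine disjoint_segment_of_separated (hpos c h1 (by omega)) (hpos d (by omega) h3) ?_ ?_
    · rw [hflo]; unfold signedArea; apply le_of_eq; ring
    · rw [hfhi]; unfold signedArea; apply le_of_eq; ring
  have hmixed : ∀ a b c d, lo ≤ a → a < b → b ≤ k → k ≤ c → c < d → d ≤ hi → b ≠ c →
      Disjoint (segment ℝ (f a) (f b)) (segment ℝ (f c) (f d)) := by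
    intro a b c d h1 h2 h3 h4 h5 h6 h7
    rcases h3.eq_or_lt with rfl | h3
    · refine (disjoint_segment_of_separated (p := u) (q := w) ?_ ?_ ?_ ?_).symm
      · rw [signedArea_swap]; linarith [hLneg c (by omega) (by omega)]
      · rw [signedArea_swap]; linarith [hLneg d (by omega) (by omega)]
      · rw [signedArea_swap]; linarith [hLpos a (by omega) (by omega)]
      · rw [signedArea_swap]; linarith
    · refine disjoint_segment_of_separated (p := w) (q := u) (hLpos a h1 (by omega))
        (hLpos b (by omega) h3) ?_ (hLneg d (by omega) h6).le
      rcases h4.eq_or_lt with rfl | h4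
      · exact hLk.le
      · exact (hLneg c h4 (by omega)).le
  refine ⟨f, hflo, hfhi, hinj, hmaps, ?_⟩
  intro a b c d h1 h2 h3 h4 h5 h6 hab hcd hac had hbc hbd
  have split : ∀ a b, lo ≤ a → a < b → b ≤ hi → R a b → b ≤ k ∨ k ≤ a ∨ (a = lo ∧ b = hi) := by
    intro a b h1 h2 h3 hab
    by_cases hb : b ≤ k
    · exact Or.inl hb
    by_cases ha : k ≤ a
    · exact Or.inr (Or.inl ha)
    · exact Or.inr (Or.inr (hk a b h1 (by omega) (by omega) h3 hab))
  rcases split a b h1 h2 h3 hab with hb | ha | ⟨rfl, rfl⟩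
  · rcases split c d h4 h5 h6 hcd with hd | hc | ⟨rfl, rfl⟩
    · rw [hfl a (by omega), hfl b hb, hfl c (by omega), hfl d hd]
      exact hf₁ a b c d h1 h2 hb h4 h5 hd hab hcd hac had hbc hbd
    · exact hmixed a b c d h1 h2 hb hc h5 h6 hbc
    · exact hbase a b (by omega) h2 (by omega)
  · rcases split c d h4 h5 h6 hcd with hd | hc | ⟨rfl, rfl⟩
    · exact (hmixed c d a b h4 h5 hd ha h2 h3 had.symm).symm
    · rw [hfr a ha, hfr b (by omega), hfr c hc, hfr d (by omega)]
      exact hf₂ a b c d ha h2 h3 hc h5 h6 hab hcd hac had hbc hbd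
    · exact hbase a b (by omega) h2 (by omega)
  · exact (hbase c d (by omega) h5 (by omega)).symm

theorem not_disjoint_diagonals {p₁ p₂ p₃ p₄ : ℝ × ℝ} (h₁₂₃ : 0 < signedArea p₁ p₂ p₃)
    (h₁₂₄ : 0 < signedArea p₁ p₂ p₄) (h₁₃₄ : 0 < signedArea p₁ p₃ p₄)
    (h₂₃₄ : 0 < signedArea p₂ p₃ p₄) : ¬ Disjoint (segment ℝ p₁ p₃) (segment ℝ p₂ p₄) := by
  have hsum : signedArea p₂ p₃ p₄ + signedArea p₁ p₂ p₄ =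
      signedArea p₁ p₃ p₄ + signedArea p₁ p₂ p₃ := by unfold signedArea; ring
  set N := signedArea p₁ p₃ p₄ + signedArea p₁ p₂ p₃ with hN
  have hN0 : 0 < N := by positivity
  rw [Set.not_disjoint_iff]
  refine ⟨(signedArea p₂ p₃ p₄ / N) • p₁ + (signedArea p₁ p₂ p₄ / N) • p₃,
    ⟨_, _, by positivity, by positivity, by rw [← add_div, hsum, div_self hN0.ne'], rfl⟩,
    ⟨signedArea p₁ p₃ p₄ / N, signedArea p₁ p₂ p₃ / N, by positivity, by positivity,
      by rw [← add_div, ← hN, div_self hN0.ne'], ?_⟩⟩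
  ext
  · simp only [Prod.fst_add, Prod.smul_fst, smul_eq_mul]
    field_simp
    unfold signedArea
    ring
  · simp only [Prod.snd_add, Prod.smul_snd, smul_eq_mul]
    field_simp
    unfold signedArea
    ring

theorem mem_convexHull_of_signedArea_nonneg {s : Set (ℝ × ℝ)} {a b c x : ℝ × ℝ} (ha : a ∈ s)
    (hb : b ∈ s) (hc : c ∈ s) (habc : 0 < signedArea a b c) (h₁ : 0 ≤ signedArea a b x)
    (h₂ : 0 ≤ signedArea b c x) (h₃ : 0 ≤ signedArea c a x) : x ∈ convexHull ℝ s := by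
  have hsum : signedArea b c x / signedArea a b c + signedArea c a x / signedArea a b c +
      signedArea a b x / signedArea a b c = 1 := by
    field_simp
    unfold signedArea
    ring
  have hx : x = (signedArea b c x / signedArea a b c) • a +
      (signedArea c a x / signedArea a b c) • b + (signedArea a b x / signedArea a b c) • c := by
    ext
    · simp only [Prod.fst_add, Prod.smul_fst, smul_eq_mul]
      field_simp
      unfold signedArea
      ring
    · simp only [Prod.snd_add, Prod.smul_snd, smul_eq_mul]
      field_simp
      unfold signedArea
      ring
  rw [hx]
  have hs := subset_convexHull ℝ s
  have := (convex_convexHull ℝ s).sum_mem (t := Finset.univ)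
    (w := ![signedArea b c x / signedArea a b c, signedArea c a x / signedArea a b c,
      signedArea a b x / signedArea a b c]) (z := ![a, b, c])
    (by intro i _; fin_cases i <;> simp <;> positivity)
    (by simpa [Fin.sum_univ_three] using hsum)
    (by intro i _; fin_cases i <;> simp [hs ha, hs hb, hs hc])
  simpa [Fin.sum_univ_three] using this

/-- Points in strictly convex position can be listed in counterclockwise order. -/
theorem exists_ccw_order {n : ℕ} (g : Fin n → ℝ × ℝ) (hg : Function.Injective g)
    (hconv : InStrictlyConvexPosition (Set.range g)) :
    ∃ σ : Equiv.Perm (Fin n), ∀ i j k, i < j → j < k →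
      0 < signedArea (g (σ i)) (g (σ j)) (g (σ k)) := by
  rcases Nat.eq_zero_or_pos n with rfl | hn
  · exact ⟨1, fun i => i.elim0⟩
  set z : Fin n := ⟨0, hn⟩
  have hne : ∀ i j, i ≠ j → g i ∈ Set.range g \ {g j} := fun i j h =>
    ⟨⟨i, rfl⟩, fun h' => h (hg h')⟩
  have hclosed : IsClosed (convexHull ℝ (Set.range g \ {g z})) :=
    ((Set.finite_range g).subset Set.sdiff_subset).isClosed_convexHull ℝ
  obtain ⟨φ, u, hφz, hφ⟩ := geometric_hahn_banach_point_closed (convex_convexHull ℝ _)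
    hclosed (hconv (g z) ⟨z, rfl⟩)
  have hφeq : ∀ v : ℝ × ℝ, φ v = v.1 * φ (1, 0) + v.2 * φ (0, 1) := by
    intro v
    have : v = v.1 • ((1, 0) : ℝ × ℝ) + v.2 • ((0, 1) : ℝ × ℝ) := by ext <;> simp
    conv_lhs => rw [this]
    rw [map_add, map_smul, map_smul, smul_eq_mul, smul_eq_mul]
  set A := φ (1, 0)
  set B := φ (0, 1)
  let h : Fin n → ℝ := fun i => ((g i).1 - (g z).1) * A + ((g i).2 - (g z).2) * B
  have hpos : ∀ i, i ≠ z → 0 < h i := by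
    intro i hi
    have h1 := hφ (g i) (subset_convexHull ℝ _ (hne i z hi))
    rw [hφeq] at h1 hφz
    simp only [h]
    linarith
  let κ : Fin n → ℝ := fun i => (((g i).2 - (g z).2) * A - ((g i).1 - (g z).1) * B) / h i
  have harea : ∀ i j, i ≠ z → j ≠ z →
      signedArea (g z) (g i) (g j) * (A ^ 2 + B ^ 2) = h i * h j * (κ j - κ i) := by
    intro i j hi hj
    have h1 := (hpos i hi).ne'
    have h2 := (hpos j hj).ne'
    simp only [κ]
    field_simp
    simp only [h, signedArea]
    ring
  have hAB : ∀ i, i ≠ z → 0 < A ^ 2 + B ^ 2 := by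
    intro i hi
    have h1 := hpos i hi
    by_contra h2
    have hA : A = 0 := by nlinarith [sq_nonneg A, sq_nonneg B]
    have hB : B = 0 := by nlinarith [sq_nonneg A, sq_nonneg B]
    simp [h, hA, hB] at h1
  obtain ⟨M, hM⟩ := (Set.finite_range κ).bddBelow
  let key : Fin n → ℝ := fun i => if i = z then M - 1 else κ i
  have hkeyz : key z = M - 1 := if_pos rfl
  have hkey : ∀ i, i ≠ z → key i = κ i := fun i hi => if_neg hi
  have hMlt : ∀ i, i ≠ z → M - 1 < key i := by
    intro i hi
    have := hM ⟨i, rfl⟩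
    rw [hkey i hi]
    linarith
  have hbetween : ∀ i j, i ≠ z → j ≠ z → i ≠ j → κ i = κ j → h i ≤ h j → False := by
    intro i j hi hj hij hκ hle
    have h0 : signedArea (g z) (g i) (g j) = 0 := by
      have := harea i j hi hj
      rw [hκ, sub_self, mul_zero] at this
      exact (mul_eq_zero.1 this).resolve_right (hAB i hi).ne'
    have hi0 := hpos i hi
    have hj0 := hpos j hj
    refine hconv (g i) ⟨i, rfl⟩ ?_
    have hseg : g i ∈ segment ℝ (g z) (g j) := by
      refine ⟨1 - h i / h j, h i / h j, ?_, by positivity, by ring, ?_⟩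
      · rw [sub_nonneg, div_le_one hj0]; exact hle
      · unfold signedArea at h0
        ext
        · simp only [Prod.fst_add, Prod.smul_fst, smul_eq_mul]
          field_simp
          simp only [h]
          linear_combination (-B) * h0
        · simp only [Prod.snd_add, Prod.smul_snd, smul_eq_mul]
          field_simp
          simp only [h]
          linear_combination A * h0
    exact (convex_convexHull ℝ _).segment_subset (subset_convexHull ℝ _ (hne z i hi.symm))
      (subset_convexHull ℝ _ (hne j i hij.symm)) hseg
  have hkeyinj : Function.Injective key := by
    intro i j hij
    by_contra hne
    by_cases hi : i = z
    · subst hi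
      exact (hMlt j (Ne.symm hne)).ne (hkeyz.symm.trans hij)
    by_cases hj : j = z
    · subst hj
      exact (hMlt i hi).ne (hkeyz.symm.trans hij.symm)
    rw [hkey i hi, hkey j hj] at hij
    rcases le_total (h i) (h j) with hle | hle
    · exact hbetween i j hi hj hne hij hle
    · exact hbetween j i hj hi (Ne.symm hne) hij.symm hle
  refine ⟨Tuple.sort key, ?_⟩
  have hmono : StrictMono (key ∘ Tuple.sort key) :=
    (Tuple.monotone_sort key).strictMono_of_injective
      (hkeyinj.comp (Tuple.sort key).injective)
  have hnz : ∀ i j, i < j → Tuple.sort key j ≠ z := by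
    intro i j hij hz
    have h1 : key (Tuple.sort key i) < key (Tuple.sort key j) := hmono hij
    rw [hz, hkeyz] at h1
    by_cases hi : Tuple.sort key i = z
    · rw [hi, hkeyz] at h1
      exact lt_irrefl _ h1
    · exact lt_asymm h1 (hMlt _ hi)
  have hlt : ∀ i j, i < j → Tuple.sort key i ≠ z →
      0 < signedArea (g z) (g (Tuple.sort key i)) (g (Tuple.sort key j)) := by
    intro i j hij hi
    have h1 : key (Tuple.sort key i) < key (Tuple.sort key j) := hmono hij
    have hj := hnz i j hij
    rw [hkey _ hi, hkey _ hj] at h1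
    rw [← mul_pos_iff_of_pos_right (hAB _ hi), harea _ _ hi hj]
    exact mul_pos (mul_pos (hpos _ hi) (hpos _ hj)) (sub_pos.2 h1)
  intro i j k hij hjk
  have hj := hnz i j hij
  by_cases hi : Tuple.sort key i = z
  · rw [hi]
    exact hlt j k hjk hj
  by_contra hneg
  refine hconv (g (Tuple.sort key j)) ⟨_, rfl⟩ ?_
  have inj := (Tuple.sort key).injective
  refine mem_convexHull_of_signedArea_nonneg (hne z _ (Ne.symm hj))
    (hne (Tuple.sort key i) _ fun h => hij.ne (inj h))
    (hne (Tuple.sort key k) _ fun h => hjk.ne' (inj h)) (hlt i k (hij.trans hjk) hi)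
    (hlt i j hij hi).le ?_ ?_
  · have : signedArea (g (Tuple.sort key i)) (g (Tuple.sort key k)) (g (Tuple.sort key j)) =
      -signedArea (g (Tuple.sort key i)) (g (Tuple.sort key j)) (g (Tuple.sort key k)) := by
      unfold signedArea; ring
    rw [this]
    linarith
  · rw [signedArea_rotate, signedArea_rotate]
    exact (hlt j k hjk hj).le

theorem exists_hull_edge {T : Finset (ℝ × ℝ)} (hT : InGeneralPosition T) (hcard : 2 ≤ T.card)
    {p : ℝ × ℝ} (hp : p ∈ T) (hmin : ∀ r ∈ T, r ≠ p → p.1 < r.1) :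
    ∃ q ∈ T, p ≠ q ∧ ∀ r ∈ T, r ≠ p → r ≠ q → 0 < signedArea p q r := by
  have hne : (T.erase p).Nonempty := by
    have := Finset.card_erase_add_one hp
    exact Finset.card_pos.1 (by omega)
  obtain ⟨q, hq, hqmin⟩ := Finset.exists_min_image (T.erase p)
    (fun r => (r.2 - p.2) / (r.1 - p.1)) hne
  obtain ⟨hqp, hqT⟩ := Finset.mem_erase.1 hq
  refine ⟨q, hqT, hqp.symm, fun r hr hrp hrq => ?_⟩
  refine lt_of_le_of_ne ?_ (hT p hp q hqT r hr hqp.symm hrp.symm hrq.symm).symm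
  have h1 := hqmin r (Finset.mem_erase.2 ⟨hrp, hr⟩)
  rw [div_le_div_iff₀ (sub_pos.2 (hmin q hqT hqp)) (sub_pos.2 (hmin r hr hrp))] at h1
  unfold signedArea
  linarith

theorem isCrossingFreeDrawing_of_disjoint {V : Type*} {G : SimpleGraph V} {f : V → ℝ × ℝ}
    (hf : Function.Injective f)
    (hgen : ∀ a b c, a ≠ b → a ≠ c → b ≠ c → signedArea (f a) (f b) (f c) ≠ 0)
    (hdisj : ∀ a b c d, G.Adj a b → G.Adj c d → a ≠ c → a ≠ d → b ≠ c → b ≠ d →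
      Disjoint (segment ℝ (f a) (f b)) (segment ℝ (f c) (f d))) :
    IsCrossingFreeDrawing G f := by
  refine ⟨hf, fun a b c d hab hcd hne => ?_⟩
  have shared : ∀ a b d, G.Adj a b → G.Adj a d → b ≠ d →
      segment ℝ (f a) (f b) ∩ segment ℝ (f a) (f d) = f '' (({a, b} : Set V) ∩ {a, d}) := by
    intro a b d hab had hbd
    have h : (({a, b} : Set V) ∩ {a, d}) = {a} := by
      ext x
      simp only [Set.mem_inter_iff, Set.mem_insert_iff, Set.mem_singleton_iff]
      constructor
      · rintro ⟨h | h, h' | h'⟩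
        · exact h
        · exact h
        · exact h'
        · exact absurd (h.symm.trans h') hbd
      · intro h
        exact ⟨Or.inl h, Or.inl h⟩
    rw [h, Set.image_singleton,
      segment_inter_segment_of_signedArea_ne_zero (hgen a b d hab.ne had.ne hbd)]
  by_cases hac : a = c
  · subst hac
    exact shared a b d hab hcd fun h => hne (by rw [h])
  by_cases had : a = d
  · subst had
    rw [segment_symm ℝ (f c), Set.pair_comm c]
    exact shared a b c hab hcd.symm fun h => hne (by rw [h, Sym2.eq_swap])
  by_cases hbc : b = c
  · subst hbc
    rw [segment_symm ℝ (f a), Set.pair_comm a]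
    exact shared b a d hab.symm hcd fun h => hne (by rw [h, Sym2.eq_swap])
  by_cases hbd : b = d
  · subst hbd
    rw [segment_symm ℝ (f a), Set.pair_comm a, segment_symm ℝ (f c), Set.pair_comm c]
    exact shared b a c hab.symm hcd.symm hac
  rw [(hdisj a b c d hab hcd hac had hbc hbd).inter_eq]
  symm
  rw [Set.image_eq_empty, Set.eq_empty_iff_forall_notMem]
  rintro x ⟨h | h, h' | h'⟩
  · exact hac (h.symm.trans h')
  · exact had (h.symm.trans h')
  · exact hbc (h.symm.trans h')
  · exact hbd (h.symm.trans h')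

/-- An outerplanar graph can be drawn on every point set in general position of the right
cardinality. -/
theorem exists_drawing_on_generalPosition {n : ℕ} (hn : 2 ≤ n) {G : SimpleGraph (Fin n)}
    {g : Fin n → ℝ × ℝ} (hg : IsCrossingFreeDrawing G g)
    (hconv : InStrictlyConvexPosition (Set.range g)) {T : Finset (ℝ × ℝ)} (hcard : T.card = n)
    (hT : InGeneralPosition T) {p q : ℝ × ℝ} (hp : p ∈ T) (hq : q ∈ T) (hpq : p ≠ q)
    (hull : ∀ r ∈ T, r ≠ p → r ≠ q → 0 < signedArea p q r) :
    ∃ f : Fin n → ℝ × ℝ, IsCrossingFreeDrawing G f ∧ Set.range f = T := by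
  obtain ⟨σ, hσ⟩ := exists_ccw_order g hg.1 hconv
  let R : ℕ → ℕ → Prop := fun i j => ∃ (hi : i < n) (hj : j < n), G.Adj (σ ⟨i, hi⟩) (σ ⟨j, hj⟩)
  have hR : ∀ a b c d, a < b → b < c → c < d → R a c → ¬ R b d := by
    rintro a b c d hab hbc hcd ⟨ha, hc, hac⟩ ⟨hb, hd, hbd⟩
    have ne : ∀ i j (hi : i < n) (hj : j < n), i ≠ j → σ ⟨i, hi⟩ ≠ σ ⟨j, hj⟩ := by
      intro i j hi hj hij h
      exact hij (Fin.mk.inj (σ.injective h))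
    have hdisj := hg.2 _ _ _ _ hac hbd (by
      rw [Ne, Sym2.eq_iff]
      rintro (⟨h, -⟩ | ⟨h, -⟩)
      · exact ne a b ha hb (by omega) h
      · exact ne a d ha hd (by omega) h)
    refine not_disjoint_diagonals (hσ ⟨a, ha⟩ ⟨b, hb⟩ ⟨c, hc⟩ hab hbc)
      (hσ ⟨a, ha⟩ ⟨b, hb⟩ ⟨d, hd⟩ hab (hbc.trans hcd))
      (hσ ⟨a, ha⟩ ⟨c, hc⟩ ⟨d, hd⟩ (hab.trans hbc) hcd)
      (hσ ⟨b, hb⟩ ⟨c, hc⟩ ⟨d, hd⟩ hbc hcd) ?_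
    rw [Set.disjoint_iff_inter_eq_empty, hdisj, Set.image_eq_empty,
      Set.eq_empty_iff_forall_notMem]
    rintro x ⟨h | h, h' | h'⟩
    · exact ne a b ha hb (by omega) (h.symm.trans h')
    · exact ne a d ha hd (by omega) (h.symm.trans h')
    · exact ne c b hc hb (by omega) (h.symm.trans h')
    · exact ne c d hc hd (by omega) (h.symm.trans h')
  obtain ⟨F, -, -, hinj, hmaps, hdisj⟩ := exists_drawing_of_noncrossing R hR (n - 2) 0 (n - 1)
    (by omega) T p q (by omega) hT hp hq hpq hull
  have hmem : ∀ v : Fin n, ((σ.symm v : Fin n) : ℕ) ∈ Set.Icc 0 (n - 1) := fun v =>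
    ⟨Nat.zero_le _, by have := (σ.symm v).isLt; omega⟩
  set f : Fin n → ℝ × ℝ := fun v => F (σ.symm v) with hf
  have hfinj : Function.Injective f := fun v w h =>
    σ.symm.injective (Fin.ext (hinj (hmem v) (hmem w) h))
  have hfT : ∀ v, f v ∈ T := fun v => hmaps (hmem v)
  have hRadj : ∀ v w, G.Adj v w → R (σ.symm v) (σ.symm w) := fun v w h =>
    ⟨(σ.symm v).isLt, (σ.symm w).isLt, by simpa using h⟩
  have hval : ∀ v w : Fin n, v ≠ w → ((σ.symm v : Fin n) : ℕ) ≠ (σ.symm w : Fin n) :=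
    fun v w h h' => h (σ.symm.injective (Fin.ext h'))
  refine ⟨f, isCrossingFreeDrawing_of_disjoint hfinj ?_ ?_, ?_⟩
  · intro a b c hab hac hbc
    exact hT _ (hfT a) _ (hfT b) _ (hfT c) (hfinj.ne hab) (hfinj.ne hac) (hfinj.ne hbc)
  · have ordered : ∀ a b c d, G.Adj a b → G.Adj c d → a ≠ c → a ≠ d → b ≠ c → b ≠ d →
        σ.symm a < σ.symm b → σ.symm c < σ.symm d →
        Disjoint (segment ℝ (f a) (f b)) (segment ℝ (f c) (f d)) :=
      fun a b c d hab hcd hac had hbc hbd h1 h2 =>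
        hdisj _ _ _ _ (Nat.zero_le _) h1 (hmem b).2 (Nat.zero_le _) h2 (hmem d).2
          (hRadj a b hab) (hRadj c d hcd) (hval a c hac) (hval a d had) (hval b c hbc)
          (hval b d hbd)
    intro a b c d hab hcd hac had hbc hbd
    rcases (σ.symm.injective.ne hab.ne).lt_or_gt with h1 | h1 <;>
      rcases (σ.symm.injective.ne hcd.ne).lt_or_gt with h2 | h2
    · exact ordered a b c d hab hcd hac had hbc hbd h1 h2
    · rw [segment_symm ℝ (f c)]
      exact ordered a b d c hab hcd.symm had hac hbd hbc h1 h2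
    · rw [segment_symm ℝ (f a)]
      exact ordered b a c d hab.symm hcd hbc hbd hac had h1 h2
    · rw [segment_symm ℝ (f a), segment_symm ℝ (f c)]
      exact ordered b a d c hab.symm hcd.symm hbd hbc had hac h1 h2
  · have h1 : Finset.univ.image f = T := by
      refine Finset.eq_of_subset_of_card_le ?_ ?_
      · intro x hx
        obtain ⟨v, -, rfl⟩ := Finset.mem_image.1 hx
        exact hfT v
      · rw [Finset.card_image_of_injective _ hfinj, hcard, Finset.card_univ, Fintype.card_fin]
    rw [← h1]
    simp

/-- The points `(i, i² mod p)` with `i < p` are in general position. -/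
theorem signedArea_quadraticResidue_ne_zero {p : ℕ} (hp : p.Prime) {i j k : ℕ} (hi : i < p)
    (hj : j < p) (hk : k < p) (hij : i ≠ j) (hik : i ≠ k) (hjk : j ≠ k) :
    signedArea (intToPlane (i, (i ^ 2 % p : ℕ))) (intToPlane (j, (j ^ 2 % p : ℕ)))
      (intToPlane (k, (k ^ 2 % p : ℕ))) ≠ 0 := by
  intro h
  have := Fact.mk hp
  simp only [signedArea, intToPlane] at h
  have h1 : ((j : ℤ) - i) * ((k ^ 2 % p : ℕ) - (i ^ 2 % p : ℕ)) -
      ((j ^ 2 % p : ℕ) - (i ^ 2 % p : ℕ)) * ((k : ℤ) - i) = 0 := by exact_mod_cast h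
  have h2 := congrArg (Int.cast : ℤ → ZMod p) h1
  simp only [Int.cast_sub, Int.cast_mul, Int.cast_natCast, ZMod.natCast_mod, Nat.cast_pow,
    Int.cast_zero] at h2
  have h3 : ((j : ZMod p) - i) * ((k - i) * (k - j)) = 0 := by linear_combination h2
  have inj : ∀ a b : ℕ, a < p → b < p → (a : ZMod p) - b = 0 → a = b := by
    intro a b ha hb hab
    have := (ZMod.natCast_eq_natCast_iff' a b p).1 (sub_eq_zero.1 hab)
    rwa [Nat.mod_eq_of_lt ha, Nat.mod_eq_of_lt hb] at this
  rcases mul_eq_zero.1 h3 with h | h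
  · exact hij (inj j i hj hi h).symm
  rcases mul_eq_zero.1 h with h | h
  · exact hik (inj k i hk hi h).symm
  · exact hjk (inj k j hk hj h).symm

theorem intToPlane_injective : Function.Injective intToPlane := by
  rintro ⟨a, b⟩ ⟨c, d⟩ h
  simpa [intToPlane] using h

/-- Any number of outerplanar graphs on `n` vertices can be simultaneously embedded
without mapping on an `O(n) × O(n)` integer grid: there is a single set `P` of `n`
integer points with coordinates in `[0, c·n]` such that every outerplanar graph on
`n` vertices has a crossing-free straight-line drawing with vertex-image set
exactly `P`. -/
theorem outerplanar_graphs_common_point_set :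
    ∃ c : ℝ, 0 < c ∧ ∀ n : ℕ, 1 ≤ n →
      ∃ P : Finset (ℤ × ℤ), P.card = n ∧
        (∀ z ∈ P, 0 ≤ z.1 ∧ (z.1 : ℝ) ≤ c * n ∧ 0 ≤ z.2 ∧ (z.2 : ℝ) ≤ c * n) ∧
        ∀ G : SimpleGraph (Fin n),
          (∃ g : Fin n → ℝ × ℝ, IsCrossingFreeDrawing G g ∧
            InStrictlyConvexPosition (Set.range g)) →
          ∃ f : Fin n → ℝ × ℝ, IsCrossingFreeDrawing G f ∧
            Set.range f = intToPlane '' (P : Set (ℤ × ℤ)) := by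
  refine ⟨2, two_pos, fun n hn => ?_⟩
  obtain ⟨p, hp, hnp, hp2⟩ := Nat.exists_prime_lt_and_le_two_mul n (by omega)
  let pt : ℕ → ℤ × ℤ := fun i => (i, (i ^ 2 % p : ℕ))
  have hpt : Function.Injective pt := by
    intro i j h
    simpa [pt] using congrArg Prod.fst h
  have hcard : ((Finset.range n).image pt).card = n := by
    rw [Finset.card_image_of_injective _ hpt, Finset.card_range]
  refine ⟨(Finset.range n).image pt, hcard, ?_, ?_⟩
  · intro z hz
    obtain ⟨i, hi, rfl⟩ := Finset.mem_image.1 hz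
    have hi : i < n := Finset.mem_range.1 hi
    have hmod : i ^ 2 % p < p := Nat.mod_lt _ hp.pos
    have h1 : i ≤ 2 * n := by omega
    have h2 : i ^ 2 % p ≤ 2 * n := by omega
    refine ⟨Int.natCast_nonneg _, ?_, Int.natCast_nonneg _, ?_⟩
    · simp only [pt, Int.cast_natCast]
      exact_mod_cast h1
    · simp only [pt, Int.cast_natCast]
      exact_mod_cast h2
  rintro G ⟨g, hg, hconv⟩
  rcases hn.eq_or_lt with rfl | hn
  · refine ⟨fun _ => intToPlane (pt 0), ⟨Function.injective_of_subsingleton _, ?_⟩, by simp⟩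
    intro a b _ _ hab
    exact absurd (Subsingleton.elim a b) hab.ne
  set T := ((Finset.range n).image pt).image intToPlane with hTdef
  have memT : ∀ r, r ∈ T ↔ ∃ i < n, intToPlane (pt i) = r := by
    intro r; simp [hTdef]
  have hTcard : T.card = n := by
    rw [hTdef, Finset.card_image_of_injective _ intToPlane_injective, hcard]
  have hT : InGeneralPosition T := by
    intro x hx y hy z hz hxy hxz hyz
    obtain ⟨i, hi, rfl⟩ := (memT x).1 hx
    obtain ⟨j, hj, rfl⟩ := (memT y).1 hy
    obtain ⟨k, hk, rfl⟩ := (memT z).1 hz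
    exact signedArea_quadraticResidue_ne_zero hp (hi.trans hnp) (hj.trans hnp) (hk.trans hnp)
      (by rintro rfl; exact hxy rfl) (by rintro rfl; exact hxz rfl) (by rintro rfl; exact hyz rfl)
  have h0 : intToPlane (pt 0) ∈ T := (memT _).2 ⟨0, by omega, rfl⟩
  obtain ⟨q, hq, hne, hull⟩ := exists_hull_edge hT (by omega) h0 (by
    intro r hr hr0
    obtain ⟨i, hi, rfl⟩ := (memT r).1 hr
    have : 0 < i := Nat.pos_of_ne_zero (by rintro rfl; exact hr0 rfl)
    simpa [intToPlane, pt] using this)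
  obtain ⟨f, hf, hrange⟩ := exists_drawing_on_generalPosition hn hg hconv hTcard hT h0 hq hne hull
  exact ⟨f, hf, by rw [hrange, hTdef, Finset.coe_image]⟩
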